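/- Let α ∈ (1/2, 1), let τ₀ > 0, k₀ > 0 and c > 0, and set σ₀ = k₀ E_α(−(c/τ₀)^α) (so that 0 < σ₀ < k₀). Define σ_R(t) = k₀ E_α(−((t + c)/τ₀)^α) (the relaxation modulus of the nonlinear RET model with initial value σ_R(0) = σ₀) and σ_F(t) = σ₀ E_α(−(t/τ₀)^α) (the relaxation modulus of the fractional Maxwell model with the same initial value). Then for every t > 0 one has the strict double inequality σ_F(t) < σ_R(t) < (k₀/σ₀) σ_F(t). -/

import Mathlib

/-- The two-parameter Mittag-Leffler function `E_{α,β}(x) = ∑ x ^ k / Γ(α k + β)`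
for real `x`. The classical Mittag-Leffler function is `E_α = E_{α,1}`. -/
noncomputable def mittagLeffler (α β : ℝ) (x : ℝ) : ℝ :=
  ∑' k : ℕ, x ^ k / Real.Gamma (α * k + β)

open Set MeasureTheory Filter Topology

section MittagLeffler

lemma rpow_mul_exp_neg_le_Gamma_add_one {M a : ℝ} (hM : 0 < M) (ha : 0 ≤ a) :
    M ^ a * Real.exp (-M) ≤ Real.Gamma (a + 1) := by
  have hconv := Real.GammaIntegral_convergent (s := a + 1) (by linarith)
  rw [Real.Gamma_eq_integral (by linarith), ← integral_exp_neg_Ioi M, ← integral_const_mul]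
  have hsub : Ioi M ⊆ Ioi (0 : ℝ) := Ioi_subset_Ioi hM.le
  refine (setIntegral_mono_on ?_ (hconv.mono_set hsub) measurableSet_Ioi ?_).trans
    (setIntegral_mono_set hconv ?_ hsub.eventuallyLE)
  · exact (integrableOn_exp_neg_Ioi M).const_mul _
  · intro x hx
    have hx' : M < x := hx
    rw [mul_comm, add_sub_cancel_right]
    gcongr
  · filter_upwards [ae_restrict_mem measurableSet_Ioi] with x hx
    have hx' : (0 : ℝ) < x := hx
    simp only [Pi.zero_apply]
    positivity

lemma summable_mittagLeffler {α : ℝ} (hα : 0 < α) {x : ℝ} (hx : 0 ≤ x) :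
    Summable fun k : ℕ => x ^ k / Real.Gamma (α * k + 1) := by
  set M : ℝ := (2 * x + 1) ^ α⁻¹ with hM_def
  have hM : 0 < M := by positivity
  have hMα : M ^ α = 2 * x + 1 := by
    rw [hM_def, ← Real.rpow_mul (by positivity), inv_mul_cancel₀ hα.ne', Real.rpow_one]
  have hr : x / (2 * x + 1) < 1 := by
    rw [div_lt_one (by positivity)]; linarith
  refine Summable.of_nonneg_of_le (fun k => ?_) (fun k => ?_)
    ((summable_geometric_of_lt_one (by positivity) hr).mul_left (Real.exp M))
  · have := Real.Gamma_pos_of_pos (s := α * k + 1) (by positivity)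
    positivity
  · have h := rpow_mul_exp_neg_le_Gamma_add_one hM (a := α * k) (by positivity)
    rw [Real.rpow_mul hM.le, hMα, Real.rpow_natCast] at h
    calc x ^ k / Real.Gamma (α * k + 1) ≤ x ^ k / ((2 * x + 1) ^ k * Real.exp (-M)) := by
          gcongr
      _ = Real.exp M * (x / (2 * x + 1)) ^ k := by
          rw [Real.exp_neg, div_pow]
          field_simp

lemma hasSum_mittagLeffler {α : ℝ} (hα : 0 < α) (x : ℝ) :
    HasSum (fun k : ℕ => x ^ k / Real.Gamma (α * k + 1)) (mittagLeffler α 1 x) := by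
  refine Summable.hasSum (Summable.of_norm ?_)
  refine (summable_mittagLeffler hα (abs_nonneg x)).congr fun k => ?_
  have := Real.Gamma_pos_of_pos (s := α * k + 1) (by positivity)
  rw [norm_div, norm_pow, Real.norm_eq_abs, Real.norm_of_nonneg this.le]

lemma continuous_mittagLeffler {α : ℝ} (hα : 0 < α) : Continuous (mittagLeffler α 1) := by
  rw [continuous_iff_continuousAt]
  intro x
  have h : ContinuousOn (mittagLeffler α 1) (Metric.ball 0 (|x| + 1)) := by
    refine continuousOn_tsum (fun k => by fun_prop)
      (summable_mittagLeffler hα (x := |x| + 1) (by positivity)) fun k y hy => ?_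
    have := Real.Gamma_pos_of_pos (s := α * k + 1) (by positivity)
    rw [norm_div, norm_pow, Real.norm_of_nonneg this.le]
    rw [mem_ball_zero_iff] at hy
    gcongr
  refine h.continuousAt (Metric.isOpen_ball.mem_nhds ?_)
  rw [mem_ball_zero_iff, Real.norm_eq_abs]
  linarith

lemma mittagLeffler_zero (α : ℝ) : mittagLeffler α 1 0 = 1 := by
  rw [mittagLeffler, tsum_eq_single 0]
  · simp
  · intro k hk
    simp [hk]

lemma intervalIntegrable_sub_rpow {α : ℝ} (hα : 0 < α) (t a b : ℝ) :
    IntervalIntegrable (fun s => (t - s) ^ (α - 1)) volume a b := by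
  have h := (intervalIntegral.intervalIntegrable_rpow' (r := α - 1) (by linarith)
    (a := t - a) (b := t - b)).comp_sub_left t
  simpa using h

lemma integral_sub_rpow_mul_rpow {α b t : ℝ} (hα : 0 < α) (hb : 0 ≤ b) (ht : 0 < t) :
    ∫ s in (0 : ℝ)..t, (t - s) ^ (α - 1) * s ^ b =
      t ^ (b + α) * (Real.Gamma (b + 1) * Real.Gamma α / Real.Gamma (b + 1 + α)) := by
  have h := Complex.betaIntegral_scaled ((b + 1 : ℝ) : ℂ) (α : ℂ) ht
  have hB : Complex.betaIntegral ((b + 1 : ℝ) : ℂ) (α : ℂ) =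
      ((Real.Gamma (b + 1) * Real.Gamma α / Real.Gamma (b + 1 + α) : ℝ) : ℂ) := by
    rw [Complex.betaIntegral_eq_Gamma_mul_div]
    · rw [← Complex.ofReal_add, Complex.Gamma_ofReal, Complex.Gamma_ofReal, Complex.Gamma_ofReal]
      push_cast
      rfl
    · simp only [Complex.ofReal_re]; linarith
    · simpa using hα
  rw [hB] at h
  have hL : ∫ s in (0 : ℝ)..t, (s : ℂ) ^ (((b + 1 : ℝ) : ℂ) - 1) * ((t : ℂ) - s) ^ ((α : ℂ) - 1) =
      ((∫ s in (0 : ℝ)..t, (t - s) ^ (α - 1) * s ^ b : ℝ) : ℂ) := by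
    rw [← intervalIntegral.integral_ofReal]
    refine intervalIntegral.integral_congr fun s hs => ?_
    rw [uIcc_of_le ht.le] at hs
    have e1 : ((b + 1 : ℝ) : ℂ) - 1 = ((b : ℝ) : ℂ) := by push_cast; ring
    have e2 : (α : ℂ) - 1 = ((α - 1 : ℝ) : ℂ) := by push_cast; ring
    rw [e1, e2, ← Complex.ofReal_sub, ← Complex.ofReal_cpow hs.1,
      ← Complex.ofReal_cpow (by linarith [hs.2]), ← Complex.ofReal_mul, mul_comm]
  have hR : (t : ℂ) ^ (((b + 1 : ℝ) : ℂ) + (α : ℂ) - 1) = ((t ^ (b + α) : ℝ) : ℂ) := by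
    rw [Complex.ofReal_cpow ht.le]
    congr 1
    push_cast
    ring
  rw [hL, hR, ← Complex.ofReal_mul] at h
  exact_mod_cast h

/-- The relaxation function `t ↦ E_α(-t ^ α)` solves the fractional relaxation equation in its
Volterra form. -/
lemma mittagLeffler_volterra {α t : ℝ} (hα : 0 < α) (ht : 0 < t) :
    mittagLeffler α 1 (-(t ^ α)) = 1 - (Real.Gamma α)⁻¹ *
      ∫ s in (0 : ℝ)..t, (t - s) ^ (α - 1) * mittagLeffler α 1 (-(s ^ α)) := by
  have hΓ := Real.Gamma_pos_of_pos hα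
  have key : HasSum
      (fun k : ℕ => ∫ s in (0 : ℝ)..t,
        (t - s) ^ (α - 1) * ((-(s ^ α)) ^ k / Real.Gamma (α * k + 1)))
      (∫ s in (0 : ℝ)..t, (t - s) ^ (α - 1) * mittagLeffler α 1 (-(s ^ α))) := by
    have hsum := summable_mittagLeffler hα (x := t ^ α) (by positivity)
    refine intervalIntegral.hasSum_integral_of_dominated_convergence
      (fun k s => (t - s) ^ (α - 1) * ((t ^ α) ^ k / Real.Gamma (α * k + 1))) (fun k => ?_)
      (fun k => ?_) ?_ ?_ ?_
    · have hc : Continuous fun s : ℝ => (-(s ^ α)) ^ k / Real.Gamma (α * k + 1) := by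
        have := Real.continuous_rpow_const hα.le
        fun_prop
      have hm : Measurable fun s : ℝ => (t - s) ^ (α - 1) := by fun_prop
      exact (hm.mul hc.measurable).aestronglyMeasurable
    · refine Eventually.of_forall fun s hs => ?_
      rw [uIoc_of_le ht.le] at hs
      have := Real.Gamma_pos_of_pos (s := α * k + 1) (by positivity)
      have h1 : 0 ≤ t - s := by linarith [hs.2]
      have h2 : 0 < s := hs.1
      have h3 : s ≤ t := hs.2
      rw [norm_mul, norm_div, norm_pow, norm_neg, Real.norm_of_nonneg this.le,
        Real.norm_of_nonneg (by positivity), Real.norm_of_nonneg (by positivity)]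
      gcongr
    · exact Eventually.of_forall fun s _ => hsum.mul_left _
    · simp_rw [tsum_mul_left]
      exact (intervalIntegrable_sub_rpow hα t 0 t).mul_const _
    · exact Eventually.of_forall fun s _ => (hasSum_mittagLeffler hα _).mul_left _
  have hterm : ∀ k : ℕ, ∫ s in (0 : ℝ)..t,
      (t - s) ^ (α - 1) * ((-(s ^ α)) ^ k / Real.Gamma (α * k + 1)) =
      -Real.Gamma α * ((-(t ^ α)) ^ (k + 1) / Real.Gamma (α * (k + 1 : ℕ) + 1)) := by
    intro k
    have hk := Real.Gamma_pos_of_pos (s := α * k + 1) (by positivity)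
    have hb := integral_sub_rpow_mul_rpow (b := α * k) hα (by positivity) ht
    have hcongr : ∫ s in (0 : ℝ)..t,
        (t - s) ^ (α - 1) * ((-(s ^ α)) ^ k / Real.Gamma (α * k + 1)) =
        ∫ s in (0 : ℝ)..t, ((-1) ^ k / Real.Gamma (α * k + 1)) *
          ((t - s) ^ (α - 1) * s ^ (α * k)) := by
      refine intervalIntegral.integral_congr fun s hs => ?_
      rw [uIcc_of_le ht.le] at hs
      rw [Real.rpow_mul hs.1, Real.rpow_natCast, neg_pow (s ^ α)]
      ring
    have e1 : α * k + 1 + α = α * (k + 1 : ℕ) + 1 := by push_cast; ring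
    have e2 : t ^ (α * k + α) = (t ^ α) ^ (k + 1) := by
      rw [← Real.rpow_natCast, ← Real.rpow_mul ht.le]
      congr 1
      push_cast
      ring
    rw [hcongr, intervalIntegral.integral_const_mul, hb, e1, e2, neg_pow (t ^ α), pow_succ (-1 : ℝ)]
    field_simp
  simp_rw [hterm] at key
  have htail := (hasSum_nat_add_iff' 1).mpr (hasSum_mittagLeffler hα (-(t ^ α)))
  have huniq := key.unique (htail.mul_left (-Real.Gamma α))
  rw [huniq]
  simp
  field_simp
  ring

end MittagLeffler

section Volterra

/-- If `w` solves the Abel-type Volterra equation `w + G (· ^ (α - 1)) ∗ w = H` and the quotient of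
`H` by the kernel is strictly increasing, then `w` cannot reach `0` after being nonnegative. -/
lemma volterra_pos_of_nonneg_before {α G T : ℝ} (hα : α ∈ Ioo (0 : ℝ) 1) (hG : 0 < G) (hT : 0 < T)
    {w H : ℝ → ℝ} (hw : Continuous w)
    (hwH : ∀ t, 0 < t → w t = H t - G * ∫ s in (0 : ℝ)..t, (t - s) ^ (α - 1) * w s)
    (hH : ∀ t, 0 < t → t < T → H t * T ^ (α - 1) < H T * t ^ (α - 1))
    (hnonneg : ∀ t ∈ Ico 0 T, 0 ≤ w t) : 0 < w T := by
  obtain ⟨hα0, hα1⟩ := hα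
  by_contra! hwT
  obtain ⟨δ, hδ0, hδT, hδ⟩ : ∃ δ, 0 < δ ∧ δ ≤ T / 2 ∧ G * (δ ^ α / α) ≤ 1 / 2 := by
    refine ⟨min (T / 2) ((α / (2 * G)) ^ α⁻¹), by positivity, min_le_left _ _, ?_⟩
    have h1 : min (T / 2) ((α / (2 * G)) ^ α⁻¹) ^ α ≤ α / (2 * G) := by
      calc _ ≤ ((α / (2 * G)) ^ α⁻¹) ^ α := by
            gcongr
            exact min_le_right _ _
        _ = α / (2 * G) := by
            rw [← Real.rpow_mul (by positivity), inv_mul_cancel₀ hα0.ne', Real.rpow_one]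
    calc _ ≤ G * (α / (2 * G) / α) := by gcongr
      _ = 1 / 2 := by field_simp
  obtain ⟨t, ⟨ht1, ht2⟩, hmax⟩ : ∃ t ∈ Ico (T - δ) T, ∀ s ∈ Icc (T - δ) T, w s ≤ w t := by
    obtain ⟨t, ht, hmax⟩ := isCompact_Icc.exists_isMaxOn
      (nonempty_Icc.mpr (by linarith : T - δ ≤ T)) hw.continuousOn
    rcases ht.2.lt_or_eq with h | rfl
    · exact ⟨t, ⟨ht.1, h⟩, hmax⟩
    · exact ⟨t - δ, ⟨le_rfl, by linarith⟩, fun s hs =>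
        (hmax hs).trans (hwT.trans (hnonneg _ ⟨by linarith, by linarith⟩))⟩
  have ht0 : 0 < t := by linarith
  have hint : ∀ x a b, IntervalIntegrable (fun s => (x - s) ^ (α - 1) * w s) volume a b :=
    fun x a b => (intervalIntegrable_sub_rpow hα0 x a b).mul_continuousOn hw.continuousOn
  have hsplit := intervalIntegral.integral_add_adjacent_intervals (hint T 0 t) (hint T t T)
  have hhead : t ^ (α - 1) * ∫ s in (0 : ℝ)..t, (T - s) ^ (α - 1) * w s ≤
      T ^ (α - 1) * ∫ s in (0 : ℝ)..t, (t - s) ^ (α - 1) * w s := by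
    rw [← intervalIntegral.integral_const_mul, ← intervalIntegral.integral_const_mul]
    refine intervalIntegral.integral_mono_on_of_le_Ioo ht0.le ((hint _ _ _).const_mul _)
      ((hint _ _ _).const_mul _) fun s hs => ?_
    have h1 : 0 < t - s := by linarith [hs.2]
    have h2 : 0 < T - s := by linarith
    rw [← mul_assoc, ← mul_assoc, ← Real.mul_rpow ht0.le h2.le, ← Real.mul_rpow hT.le h1.le]
    refine mul_le_mul_of_nonneg_right ?_ (hnonneg s ⟨hs.1.le, by linarith⟩)
    refine Real.rpow_le_rpow_of_nonpos (by positivity) ?_ (by linarith)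
    nlinarith [hs.1]
  have htail : ∫ s in t..T, (T - s) ^ (α - 1) * w s ≤ δ ^ α / α * w t := by
    have h1 : ∫ s in t..T, (T - s) ^ (α - 1) * w s ≤ ∫ s in t..T, (T - s) ^ (α - 1) * w t := by
      refine intervalIntegral.integral_mono_on_of_le_Ioo ht2.le (hint _ _ _)
        ((intervalIntegrable_sub_rpow hα0 _ _ _).mul_const _) fun s hs => ?_
      have : 0 ≤ T - s := by linarith [hs.2]
      have := hmax s ⟨by linarith [hs.1], hs.2.le⟩
      gcongr
    have h2 : ∫ s in t..T, (T - s) ^ (α - 1) * w t = (T - t) ^ α / α * w t := by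
      rw [intervalIntegral.integral_mul_const,
        intervalIntegral.integral_comp_sub_left (fun x => x ^ (α - 1)),
        integral_rpow (Or.inl (by linarith))]
      simp [hα0.ne']
    rw [h2] at h1
    refine h1.trans ?_
    have := hnonneg t ⟨ht0.le, ht2⟩
    have : 0 ≤ T - t := by linarith
    gcongr
    linarith
  have hpow : t ^ (α - 1) ≤ 2 * T ^ (α - 1) := by
    calc t ^ (α - 1) ≤ (T / 2) ^ (α - 1) :=
          Real.rpow_le_rpow_of_nonpos (by positivity) (by linarith) (by linarith)
      _ = T ^ (α - 1) * 2 ^ (1 - α) := by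
          rw [Real.div_rpow hT.le (by norm_num), div_eq_mul_inv, ← Real.rpow_neg (by norm_num)]
          congr 2
          ring
      _ ≤ T ^ (α - 1) * 2 ^ (1 : ℝ) := by
          gcongr
          · norm_num
          · linarith
      _ = 2 * T ^ (α - 1) := by rw [Real.rpow_one, mul_comm]
  have hTw := hwH T hT
  have htw := hwH t ht0
  have hHt := hH t ht0 ht2
  have hwt := hnonneg t ⟨ht0.le, ht2⟩
  have hpt : 0 < t ^ (α - 1) := by positivity
  have hpT : 0 < T ^ (α - 1) := by positivity
  rw [← hsplit] at hTw
  set A := ∫ s in (0 : ℝ)..t, (T - s) ^ (α - 1) * w s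
  set B := ∫ s in t..T, (T - s) ^ (α - 1) * w s
  set C := ∫ s in (0 : ℝ)..t, (t - s) ^ (α - 1) * w s
  have e1 : G * (t ^ (α - 1) * A) ≤ G * (T ^ (α - 1) * C) := by gcongr
  have e2 : t ^ (α - 1) * (G * B) ≤ t ^ (α - 1) * (1 / 2 * w t) := by
    refine mul_le_mul_of_nonneg_left ?_ hpt.le
    calc G * B ≤ G * (δ ^ α / α * w t) := by gcongr
      _ = G * (δ ^ α / α) * w t := by ring
      _ ≤ _ := by gcongr
  have e3 : t ^ (α - 1) * w t ≤ 2 * T ^ (α - 1) * w t := by gcongr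
  have e4 : t ^ (α - 1) * w T ≤ 0 := mul_nonpos_of_nonneg_of_nonpos hpt.le hwT
  have e5 : t ^ (α - 1) * w T = H T * t ^ (α - 1) - G * (t ^ (α - 1) * A) -
      t ^ (α - 1) * (G * B) := by rw [hTw]; ring
  have e6 : T ^ (α - 1) * w t = H t * T ^ (α - 1) - G * (T ^ (α - 1) * C) := by rw [htw]; ring
  linarith

lemma volterra_pos {α G : ℝ} (hα : α ∈ Ioo (0 : ℝ) 1) (hG : 0 < G) {w H : ℝ → ℝ}
    (hw : Continuous w) (hw0 : 0 < w 0)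
    (hwH : ∀ t, 0 < t → w t = H t - G * ∫ s in (0 : ℝ)..t, (t - s) ^ (α - 1) * w s)
    (hH : ∀ t T, 0 < t → t < T → H t * T ^ (α - 1) < H T * t ^ (α - 1))
    {t : ℝ} (ht : 0 ≤ t) : 0 < w t := by
  by_contra! hwt
  have hcpt : IsCompact (Icc 0 t ∩ {s | w s ≤ 0}) :=
    isCompact_Icc.inter_right (isClosed_le hw continuous_const)
  obtain ⟨T, ⟨hT, hwT⟩, hmin⟩ := hcpt.exists_isLeast ⟨t, ⟨ht, le_rfl⟩, hwt⟩
  have hT0 : 0 < T := by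
    refine hT.1.lt_of_ne ?_
    rintro rfl
    exact absurd hwT (not_le.mpr hw0)
  refine not_lt_of_ge (show w T ≤ 0 from hwT) ?_
  refine volterra_pos_of_nonneg_before hα hG hT0 hw hwH (fun s hs hsT => hH s T hs hsT) ?_
  intro s hs
  by_contra! h
  exact absurd (hmin ⟨⟨hs.1, hs.2.le.trans hT.2⟩, h.le⟩) (not_le.mpr hs.2)

variable {α G : ℝ} {f : ℝ → ℝ}

lemma abel_volterra_pos (hα : α ∈ Ioo (0 : ℝ) 1) (hG : 0 < G) (hf : Continuous f) (hf0 : f 0 = 1)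
    (hV : ∀ t, 0 < t → f t = 1 - G * ∫ s in (0 : ℝ)..t, (t - s) ^ (α - 1) * f s)
    {t : ℝ} (ht : 0 ≤ t) : 0 < f t := by
  refine volterra_pos (H := fun _ => 1) hα hG hf (by simp [hf0]) hV (fun s T hs hsT => ?_) ht
  simpa using Real.rpow_lt_rpow_of_neg hs hsT (by linarith [hα.2])

lemma integral_add_sub_rpow_lt (hf : Continuous f)
    (hpos : ∀ t, 0 ≤ t → 0 < f t) {c t T a b : ℝ} (hc : 0 < c) (ht : 0 < t) (hT : 0 < T)
    (h : ∀ s ∈ Icc 0 c, a * (t + c - s) ^ (α - 1) ≤ b * (T + c - s) ^ (α - 1))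
    (h0 : a * (t + c) ^ (α - 1) < b * (T + c) ^ (α - 1)) :
    a * ∫ s in (0 : ℝ)..c, (t + c - s) ^ (α - 1) * f s <
      b * ∫ s in (0 : ℝ)..c, (T + c - s) ^ (α - 1) * f s := by
  have hcont : ∀ x, 0 < x → ∀ d : ℝ,
      ContinuousOn (fun s => d * ((x + c - s) ^ (α - 1) * f s)) (Icc 0 c) := by
    intro x hx d
    refine continuousOn_const.mul (ContinuousOn.mul ?_ hf.continuousOn)
    exact ContinuousOn.rpow_const (by fun_prop) fun s hs => Or.inl (by linarith [hs.2])
  rw [← intervalIntegral.integral_const_mul, ← intervalIntegral.integral_const_mul]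
  refine intervalIntegral.integral_lt_integral_of_continuousOn_of_le_of_exists_lt hc
    (hcont t ht _) (hcont T hT _) (fun s hs => ?_) ⟨0, ⟨le_rfl, hc.le⟩, ?_⟩
  · rw [← mul_assoc, ← mul_assoc]
    exact mul_le_mul_of_nonneg_right (h s (Ioc_subset_Icc_self hs)) (hpos s hs.1.le).le
  · rw [← mul_assoc, ← mul_assoc, sub_zero, sub_zero]
    exact mul_lt_mul_of_pos_right h0 (hpos 0 le_rfl)

lemma abel_volterra_shift (hα : 0 < α) (hf : Continuous f)
    (hV : ∀ t, 0 < t → f t = 1 - G * ∫ s in (0 : ℝ)..t, (t - s) ^ (α - 1) * f s)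
    {c t : ℝ} (hc : 0 < c) (ht : 0 < t) :
    f (t + c) = 1 - G * (∫ s in (0 : ℝ)..c, (t + c - s) ^ (α - 1) * f s) -
      G * ∫ s in (0 : ℝ)..t, (t - s) ^ (α - 1) * f (s + c) := by
  have hint : ∀ x a b, IntervalIntegrable (fun s => (x - s) ^ (α - 1) * f s) volume a b :=
    fun x a b => (intervalIntegrable_sub_rpow hα x a b).mul_continuousOn hf.continuousOn
  have hshift : ∫ s in (0 : ℝ)..t, (t - s) ^ (α - 1) * f (s + c) =
      ∫ s in c..(t + c), (t + c - s) ^ (α - 1) * f s := by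
    have := intervalIntegral.integral_comp_add_right
      (fun s => (t + c - s) ^ (α - 1) * f s) c (a := 0) (b := t)
    simpa using this
  rw [hV (t + c) (by linarith), hshift,
    ← intervalIntegral.integral_add_adjacent_intervals (hint _ 0 c) (hint _ c (t + c))]
  ring

lemma abel_volterra_lt_one (hα : α ∈ Ioo (0 : ℝ) 1) (hG : 0 < G) (hf : Continuous f)
    (hf0 : f 0 = 1)
    (hV : ∀ t, 0 < t → f t = 1 - G * ∫ s in (0 : ℝ)..t, (t - s) ^ (α - 1) * f s)
    {t : ℝ} (ht : 0 < t) : f t < 1 := by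
  rw [hV t ht, sub_lt_self_iff]
  refine mul_pos hG (intervalIntegral.intervalIntegral_pos_of_pos_on
    ((intervalIntegrable_sub_rpow hα.1 t 0 t).mul_continuousOn hf.continuousOn) ?_ ht)
  intro s hs
  have := abel_volterra_pos hα hG hf hf0 hV hs.1.le
  have : 0 < t - s := sub_pos.mpr hs.2
  positivity

lemma abel_volterra_add_lt (hα : α ∈ Ioo (0 : ℝ) 1) (hG : 0 < G) (hf : Continuous f)
    (hf0 : f 0 = 1)
    (hV : ∀ t, 0 < t → f t = 1 - G * ∫ s in (0 : ℝ)..t, (t - s) ^ (α - 1) * f s)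
    {c t : ℝ} (hc : 0 < c) (ht : 0 ≤ t) : f (t + c) < f t := by
  have hpos : ∀ t, 0 ≤ t → 0 < f t := fun t ht => abel_volterra_pos hα hG hf hf0 hV ht
  rw [← sub_pos]
  refine volterra_pos (w := fun t => f t - f (t + c))
    (H := fun t => G * ∫ s in (0 : ℝ)..c, (t + c - s) ^ (α - 1) * f s) hα hG (by fun_prop)
    ?_ (fun s hs => ?_) (fun s T hs hsT => ?_) ht
  · simpa [hf0] using abel_volterra_lt_one hα hG hf hf0 hV hc
  · have hint := intervalIntegrable_sub_rpow hα.1 s 0 s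
    simp only [mul_sub]
    rw [intervalIntegral.integral_sub (hint.mul_continuousOn hf.continuousOn)
      (hint.mul_continuousOn (by fun_prop)), abel_volterra_shift hα.1 hf hV hc hs, hV s hs]
    ring
  · have hlt : ∀ x, 0 < x →
        T ^ (α - 1) * (s + x) ^ (α - 1) < s ^ (α - 1) * (T + x) ^ (α - 1) := by
      intro x hx
      have hT : 0 < T := hs.trans hsT
      rw [← Real.mul_rpow hT.le (by positivity), ← Real.mul_rpow hs.le (by positivity)]
      exact Real.rpow_lt_rpow_of_neg (by positivity) (by nlinarith) (by linarith [hα.2])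
    have h := integral_add_sub_rpow_lt hf hpos (t := s) (T := T) (a := T ^ (α - 1))
      (b := s ^ (α - 1)) hc hs (hs.trans hsT) (fun x hx => ?_) (hlt c hc)
    · have := mul_lt_mul_of_pos_left h hG
      linarith
    · rcases hx.2.lt_or_eq with h | rfl
      · rw [add_sub_assoc, add_sub_assoc]
        exact (hlt _ (by linarith)).le
      · simp [mul_comm]

/-- Solutions of the Abel–Volterra equation are strictly supermultiplicative. -/
lemma abel_volterra_mul_lt_add (hα : α ∈ Ioo (0 : ℝ) 1) (hG : 0 < G) (hf : Continuous f)
    (hf0 : f 0 = 1)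
    (hV : ∀ t, 0 < t → f t = 1 - G * ∫ s in (0 : ℝ)..t, (t - s) ^ (α - 1) * f s)
    {c t : ℝ} (hc : 0 < c) (ht : 0 < t) : f c * f t < f (t + c) := by
  have hpos : ∀ t, 0 ≤ t → 0 < f t := fun t ht => abel_volterra_pos hα hG hf hf0 hV ht
  have hint : ∀ x, IntervalIntegrable (fun s => (x - s) ^ (α - 1) * f s) volume 0 c :=
    fun x => (intervalIntegrable_sub_rpow hα.1 x 0 c).mul_continuousOn hf.continuousOn
  set h : ℝ → ℝ := fun t => 1 - G * ∫ s in (0 : ℝ)..c, (t + c - s) ^ (α - 1) * f s with hh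
  have hmono : ∀ s T, 0 < s → s < T → h s < h T := by
    intro s T hs hsT
    have := integral_add_sub_rpow_lt (α := α) hf hpos (t := T) (T := s) (a := 1) (b := 1) hc
      (hs.trans hsT) hs (fun x hx => ?_) ?_
    · have := mul_lt_mul_of_pos_left this hG
      simp only [hh]
      linarith
    · rw [one_mul, one_mul]
      exact Real.rpow_le_rpow_of_nonpos (by linarith [hx.2]) (by linarith) (by linarith [hα.2])
    · rw [one_mul, one_mul]
      exact Real.rpow_lt_rpow_of_neg (by linarith) (by linarith) (by linarith [hα.2])
  have hlow : ∀ s, 0 < s → f c ≤ h s := by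
    intro s hs
    rw [hV c hc]
    simp only [hh]
    gcongr
    refine intervalIntegral.integral_mono_on_of_le_Ioo hc.le (hint _) (hint _) fun x hx => ?_
    refine mul_le_mul_of_nonneg_right ?_ (hpos x hx.1.le).le
    exact Real.rpow_le_rpow_of_nonpos (by linarith [hx.2]) (by linarith) (by linarith [hα.2])
  have heq : ∀ l s, 0 < s → f (s + c) - l * f s = (h s - l) -
      G * ∫ x in (0 : ℝ)..s, (s - x) ^ (α - 1) * (f (x + c) - l * f x) := by
    intro l s hs
    have hi := intervalIntegrable_sub_rpow hα.1 s 0 s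
    simp only [mul_sub, mul_left_comm _ l]
    rw [intervalIntegral.integral_sub (hi.mul_continuousOn (by fun_prop))
      ((hi.mul_continuousOn hf.continuousOn).const_mul l), intervalIntegral.integral_const_mul,
      abel_volterra_shift hα.1 hf hV hc hs, hV s hs]
    simp only [hh]
    ring
  have hquot : ∀ l, l ≤ f c → ∀ s T, 0 < s → s < T →
      (h s - l) * T ^ (α - 1) < (h T - l) * s ^ (α - 1) := by
    intro l hl s T hs hsT
    have h1 := hmono s T hs hsT
    have h2 : 0 ≤ h s - l := by linarith [hlow s hs]
    calc (h s - l) * T ^ (α - 1) ≤ (h s - l) * s ^ (α - 1) :=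
          mul_le_mul_of_nonneg_left
            (Real.rpow_le_rpow_of_nonpos hs hsT.le (by linarith [hα.2])) h2
      _ < (h T - l) * s ^ (α - 1) := by gcongr
  have hge : ∀ s, 0 ≤ s → 0 ≤ f (s + c) - f c * f s := by
    intro s hs
    have hlt : ∀ l, l < f c → l * f s < f (s + c) := by
      intro l hl
      rw [← sub_pos]
      exact volterra_pos (w := fun s => f (s + c) - l * f s) hα hG (by fun_prop)
        (by simpa [hf0] using hl) (heq l) (hquot l hl.le) hs
    rw [sub_nonneg, ← le_div_iff₀ (hpos s hs)]
    exact le_of_forall_lt fun l hl => (lt_div_iff₀ (hpos s hs)).mpr (hlt l hl)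
  rw [← sub_pos]
  exact volterra_pos_of_nonneg_before (w := fun s => f (s + c) - f c * f s) hα hG ht (by fun_prop)
    (heq (f c)) (fun s hs hst => hquot _ le_rfl s t hs hst) fun s hs => hge s hs.1

end Volterra

/-- Let `α ∈ (1/2, 1)`, `τ₀ > 0`, `k₀ > 0`, `c > 0`, and
`σ₀ = k₀ E_α(-(c/τ₀)^α)` (so `0 < σ₀ < k₀`). With
`σ_R(t) = k₀ E_α(-((t+c)/τ₀)^α)` (relaxation modulus of the nonlinear RET model,
`σ_R(0) = σ₀`) and `σ_F(t) = σ₀ E_α(-(t/τ₀)^α)` (relaxation modulus of the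
fractional Maxwell model with the same initial value), for every `t > 0` we have
`σ_F(t) < σ_R(t) < (k₀/σ₀) σ_F(t)`. -/
theorem RET_relaxation_bounds (α τ₀ k₀ c σ₀ : ℝ) (hα : α ∈ Set.Ioo (1 / 2 : ℝ) 1)
    (hτ : 0 < τ₀) (hk : 0 < k₀) (hc : 0 < c)
    (hσ₀ : σ₀ = k₀ * mittagLeffler α 1 (-((c / τ₀) ^ α)))
    (σR σF : ℝ → ℝ)
    (hσR : ∀ t, σR t = k₀ * mittagLeffler α 1 (-(((t + c) / τ₀) ^ α)))
    (hσF : ∀ t, σF t = σ₀ * mittagLeffler α 1 (-((t / τ₀) ^ α))) :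
    (0 < σ₀ ∧ σ₀ < k₀) ∧ σR 0 = σ₀ ∧
    ∀ t > (0 : ℝ), σF t < σR t ∧ σR t < (k₀ / σ₀) * σF t := by
  have hα' : α ∈ Ioo (0 : ℝ) 1 := ⟨by linarith [hα.1], hα.2⟩
  have hG : 0 < (Real.Gamma α)⁻¹ := inv_pos.mpr (Real.Gamma_pos_of_pos hα'.1)
  set f : ℝ → ℝ := fun t => mittagLeffler α 1 (-(t ^ α)) with hf_def
  have hf : Continuous f :=
    (continuous_mittagLeffler hα'.1).comp (Real.continuous_rpow_const hα'.1.le).neg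
  have hf0 : f 0 = 1 := by simp [hf_def, Real.zero_rpow hα'.1.ne', mittagLeffler_zero]
  have hV : ∀ t, 0 < t →
      f t = 1 - (Real.Gamma α)⁻¹ * ∫ s in (0 : ℝ)..t, (t - s) ^ (α - 1) * f s :=
    fun t ht => mittagLeffler_volterra hα'.1 ht
  replace hσ₀ : σ₀ = k₀ * f (c / τ₀) := hσ₀
  replace hσR : ∀ t, σR t = k₀ * f ((t + c) / τ₀) := hσR
  replace hσF : ∀ t, σF t = σ₀ * f (t / τ₀) := hσF
  have hcτ : 0 < c / τ₀ := by positivity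
  have hfc := abel_volterra_pos hα' hG hf hf0 hV hcτ.le
  have hfc1 := abel_volterra_lt_one hα' hG hf hf0 hV hcτ
  have hσ₀_pos : 0 < σ₀ := by rw [hσ₀]; positivity
  refine ⟨⟨hσ₀_pos, ?_⟩, ?_, fun t ht => ?_⟩
  · rw [hσ₀]
    exact mul_lt_of_lt_one_right hk hfc1
  · rw [hσR, zero_add, hσ₀]
  · have htτ : 0 < t / τ₀ := by positivity
    rw [hσR, hσF, add_div]
    constructor
    · rw [hσ₀, mul_assoc]
      exact mul_lt_mul_of_pos_left (abel_volterra_mul_lt_add hα' hG hf hf0 hV hcτ htτ) hk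
    · rw [← mul_assoc, div_mul_cancel₀ _ hσ₀_pos.ne']
      exact mul_lt_mul_of_pos_left (abel_volterra_add_lt hα' hG hf hf0 hV hcτ htτ.le) hk
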